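/- arXiv:1207.5648 — 6 statements merged into one kernel-verified Lean document; each statement's English description precedes it below -/
import Mathlib

section
/- Let l₁, l₂ > 0 and let ψ : ℝ² → ℂ be continuously differentiable on the closed rectangle [0, l₁] × [0, l₂]. Then for every δ with 0 < δ ≤ l₁ one has ∫₀^{l₂} |ψ(0, y)|² dy ≤ (2/δ) ∫₀^{l₁}∫₀^{l₂} |ψ(x, y)|² dy dx + 2δ ∫₀^{l₁}∫₀^{l₂} |∂ₓψ(x, y)|² dy dx. -/
open MeasureTheory

/-- One-dimensional trace estimate at the left endpoint of an interval. -/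
theorem norm_sq_left_le_integral {E : Type*} [NormedAddCommGroup E] [InnerProductSpace ℝ E]
    {f f' : ℝ → E} {l δ : ℝ} (hδ : 0 < δ) (hδl : δ ≤ l)
    (hf : ContinuousOn f (Set.Icc 0 l)) (hf' : ContinuousOn f' (Set.Icc 0 l))
    (hd : ∀ x ∈ Set.Ioo 0 l, HasDerivAt f (f' x) x) :
    ‖f 0‖ ^ 2 ≤ (2 / δ) * (∫ x in (0:ℝ)..l, ‖f x‖ ^ 2)
      + 2 * δ * (∫ x in (0:ℝ)..l, ‖f' x‖ ^ 2) := by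
  have hsub : Set.Icc 0 δ ⊆ Set.Icc 0 l := Set.Icc_subset_Icc_right hδl
  have hl : 0 ≤ l := hδ.le.trans hδl
  have hF : ContinuousOn (fun x => ‖f x‖ ^ 2) (Set.Icc 0 l) := hf.norm.pow 2
  have hF' : ContinuousOn (fun x => ‖f' x‖ ^ 2) (Set.Icc 0 l) := hf'.norm.pow 2
  have hlin : ContinuousOn (fun x : ℝ => x - δ) (Set.Icc 0 δ) := by fun_prop
  have hD : ContinuousOn (fun x => ‖f x‖ ^ 2 + (x - δ) * (2 * inner ℝ (f x) (f' x)))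
      (Set.Icc 0 δ) :=
    (hF.mono hsub).add
      (hlin.mul (continuousOn_const.mul ((hf.mono hsub).inner (𝕜 := ℝ) (hf'.mono hsub))))
  have ftc := intervalIntegral.integral_eq_sub_of_hasDerivAt_of_le hδ.le
    (hlin.mul (hF.mono hsub))
    (f' := fun x => ‖f x‖ ^ 2 + (x - δ) * (2 * inner ℝ (f x) (f' x)))
    (fun x hx => by
      have h := ((hasDerivAt_id x).sub_const δ).mul
        (hd x ⟨hx.1, hx.2.trans_le hδl⟩).norm_sq
      simpa using h)
    (hD.intervalIntegrable_of_Icc hδ.le)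
  have hle : (∫ x in (0:ℝ)..δ, (‖f x‖ ^ 2 + (x - δ) * (2 * inner ℝ (f x) (f' x))))
      ≤ ∫ x in (0:ℝ)..δ, (2 * ‖f x‖ ^ 2 + 2 * δ ^ 2 * ‖f' x‖ ^ 2) := by
    refine intervalIntegral.integral_mono_on hδ.le (hD.intervalIntegrable_of_Icc hδ.le)
      (((continuousOn_const.mul (hF.mono hsub)).add
        (continuousOn_const.mul (hF'.mono hsub))).intervalIntegrable_of_Icc hδ.le) ?_
    intro x hx
    have h1 := neg_le_of_abs_le (abs_real_inner_le_norm (f x) (f' x))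
    have h2 : (δ - x) * (‖f x‖ * ‖f' x‖) ≤ δ * (‖f x‖ * ‖f' x‖) :=
      mul_le_mul_of_nonneg_right (by linarith [hx.1]) (by positivity)
    have h3 : (δ - x) * (-inner ℝ (f x) (f' x)) ≤ (δ - x) * (‖f x‖ * ‖f' x‖) :=
      mul_le_mul_of_nonneg_left (by linarith) (by linarith [hx.2])
    nlinarith [sq_nonneg (‖f x‖ - δ * ‖f' x‖), sq_nonneg (δ * ‖f' x‖)]
  have hmono : ∀ g : ℝ → E, ContinuousOn (fun x => ‖g x‖ ^ 2) (Set.Icc 0 l) →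
      (∫ x in (0:ℝ)..δ, ‖g x‖ ^ 2) ≤ ∫ x in (0:ℝ)..l, ‖g x‖ ^ 2 := fun g hg =>
    intervalIntegral.integral_mono_interval le_rfl hδ.le hδl
      (Filter.Eventually.of_forall fun x => by positivity) (hg.intervalIntegrable_of_Icc hl)
  rw [ftc, intervalIntegral.integral_add
    (((hF.mono hsub).intervalIntegrable_of_Icc hδ.le).const_mul _)
    (((hF'.mono hsub).intervalIntegrable_of_Icc hδ.le).const_mul _),
    intervalIntegral.integral_const_mul, intervalIntegral.integral_const_mul] at hle
  have h1 := hmono f hF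
  have h2 := mul_le_mul_of_nonneg_left (hmono f' hF') (by positivity : 0 ≤ 2 * δ ^ 2)
  have key : δ * ‖f 0‖ ^ 2 ≤ δ * ((2 / δ) * (∫ x in (0:ℝ)..l, ‖f x‖ ^ 2)
      + 2 * δ * (∫ x in (0:ℝ)..l, ‖f' x‖ ^ 2)) := by
    have h3 : δ * ((2 / δ) * (∫ x in (0:ℝ)..l, ‖f x‖ ^ 2)
      + 2 * δ * (∫ x in (0:ℝ)..l, ‖f' x‖ ^ 2)) = 2 * (∫ x in (0:ℝ)..l, ‖f x‖ ^ 2)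
        + 2 * δ ^ 2 * (∫ x in (0:ℝ)..l, ‖f' x‖ ^ 2) := by
      field_simp
    rw [h3]
    simp only [Pi.mul_apply, sub_self, zero_mul, zero_sub, neg_mul, neg_neg] at hle
    linarith
  exact le_of_mul_le_mul_left key hδ

/-- Fubini for a continuous function on a closed rectangle, together with the integrability of
the partial integrals over horizontal lines. -/
theorem ContinuousOn.intervalIntegral_swap {F : ℝ × ℝ → ℝ} {l₁ l₂ : ℝ}
    (hl₁ : 0 ≤ l₁) (hl₂ : 0 ≤ l₂)
    (hF : ContinuousOn F (Set.Icc 0 l₁ ×ˢ Set.Icc 0 l₂)) :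
    IntervalIntegrable (fun y => ∫ x in (0:ℝ)..l₁, F (x, y)) volume 0 l₂ ∧
      (∫ x in (0:ℝ)..l₁, ∫ y in (0:ℝ)..l₂, F (x, y))
        = ∫ y in (0:ℝ)..l₂, ∫ x in (0:ℝ)..l₁, F (x, y) := by
  have hint : Integrable F
      ((volume.restrict (Set.Ioc 0 l₁)).prod (volume.restrict (Set.Ioc 0 l₂))) := by
    rw [Measure.prod_restrict]
    exact (hF.integrableOn_compact (isCompact_Icc.prod isCompact_Icc)).mono_set
      (Set.prod_mono Set.Ioc_subset_Icc_self Set.Ioc_subset_Icc_self)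
  simp only [intervalIntegrable_iff_integrableOn_Ioc_of_le hl₂,
    intervalIntegral.integral_of_le hl₁, intervalIntegral.integral_of_le hl₂]
  exact ⟨hint.integral_prod_right, integral_integral_swap hint⟩

/-- Edge-trace estimate on a rectangle: for `ψ` continuously differentiable on
`[0, l₁] × [0, l₂]` and `0 < δ ≤ l₁`, the `L²`-norm of the trace `ψ(0, ·)` is
controlled by the `L²`-norms of `ψ` and of its partial derivative in the first
variable. -/
theorem rectangle_edge_trace_estimate (l₁ l₂ : ℝ) (hl₁ : 0 < l₁) (hl₂ : 0 < l₂)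
    (ψ : ℝ × ℝ → ℂ) (hψ : ContDiffOn ℝ 1 ψ (Set.Icc 0 l₁ ×ˢ Set.Icc 0 l₂))
    (δ : ℝ) (hδ : 0 < δ) (hδl : δ ≤ l₁) :
    (∫ y in (0:ℝ)..l₂, ‖ψ (0, y)‖ ^ 2)
      ≤ (2 / δ) * (∫ x in (0:ℝ)..l₁, ∫ y in (0:ℝ)..l₂, ‖ψ (x, y)‖ ^ 2)
        + 2 * δ * (∫ x in (0:ℝ)..l₁, ∫ y in (0:ℝ)..l₂, ‖fderiv ℝ ψ (x, y) (1, 0)‖ ^ 2) := by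
  set R : Set (ℝ × ℝ) := Set.Icc 0 l₁ ×ˢ Set.Icc 0 l₂ with hR
  have hu : UniqueDiffOn ℝ R := (uniqueDiffOn_Icc hl₁).prod (uniqueDiffOn_Icc hl₂)
  have hG : ContinuousOn (fun p => fderivWithin ℝ ψ R p (1, 0)) R :=
    (hψ.continuousOn_fderivWithin hu le_rfl).clm_apply continuousOn_const
  have hnhds : ∀ x ∈ Set.Ioo 0 l₁, ∀ y ∈ Set.Ioo 0 l₂, R ∈ nhds (x, y) := fun x hx y hy =>
    prod_mem_nhds (Icc_mem_nhds hx.1 hx.2) (Icc_mem_nhds hy.1 hy.2)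
  have hfderiv : (∫ x in (0:ℝ)..l₁, ∫ y in (0:ℝ)..l₂, ‖fderiv ℝ ψ (x, y) (1, 0)‖ ^ 2)
      = ∫ x in (0:ℝ)..l₁, ∫ y in (0:ℝ)..l₂, ‖fderivWithin ℝ ψ R (x, y) (1, 0)‖ ^ 2 := by
    simp only [intervalIntegral.integral_of_le hl₁.le, intervalIntegral.integral_of_le hl₂.le,
      integral_Ioc_eq_integral_Ioo]
    refine setIntegral_congr_fun measurableSet_Ioo fun x hx =>
      setIntegral_congr_fun measurableSet_Ioo fun y hy => ?_
    simp only [fderivWithin_of_mem_nhds (hnhds x hx y hy)]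
  obtain ⟨hi₁, hs₁⟩ := ContinuousOn.intervalIntegral_swap hl₁.le hl₂.le
    (hψ.continuousOn.norm.pow 2)
  obtain ⟨hi₂, hs₂⟩ := ContinuousOn.intervalIntegral_swap hl₁.le hl₂.le (hG.norm.pow 2)
  simp only [Pi.pow_apply] at hi₁ hs₁ hi₂ hs₂
  rw [hfderiv, hs₁, hs₂, ← intervalIntegral.integral_const_mul,
    ← intervalIntegral.integral_const_mul,
    ← intervalIntegral.integral_add (hi₁.const_mul _) (hi₂.const_mul _)]
  have htrace : ContinuousOn (fun y => ‖ψ (0, y)‖ ^ 2) (Set.Icc 0 l₂) :=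
    (hψ.continuousOn.comp (by fun_prop) fun y hy => ⟨⟨le_rfl, hl₁.le⟩, hy⟩).norm.pow 2
  refine intervalIntegral.integral_mono_on_of_le_Ioo hl₂.le
    (htrace.intervalIntegrable_of_Icc hl₂.le)
    ((hi₁.const_mul _).add (hi₂.const_mul _)) fun y hy => ?_
  have hmaps : Set.MapsTo (fun x : ℝ => (x, y)) (Set.Icc 0 l₁) R := fun x hx =>
    ⟨hx, Set.Ioo_subset_Icc_self hy⟩
  refine norm_sq_left_le_integral (f := fun x => ψ (x, y)) hδ hδl
    (hψ.continuousOn.comp (by fun_prop) hmaps) (hG.comp (by fun_prop) hmaps) fun x hx => ?_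
  have hd : HasFDerivAt ψ (fderivWithin ℝ ψ R (x, y)) (x, y) :=
    ((hψ.differentiableOn one_ne_zero _
      (hmaps (Set.Ioo_subset_Icc_self hx))).hasFDerivWithinAt).hasFDerivAt (hnhds x hx y hy)
  exact hd.comp_hasDerivAt x ((hasDerivAt_id x).prodMk (hasDerivAt_const x y))
end

section
/- Let l > 0, let T⁺ = {(x, y) ∈ ℝ² : 0 ≤ y ≤ x ≤ l} and T⁻ = {(x, y) ∈ ℝ² : 0 ≤ x ≤ y ≤ l}, and let α : ℝ → ℝ be measurable with |α(t)| ≤ M for all t ∈ [0, l], for some M ≥ 0. Then there exists a constant C > 0 such that for all functions ψ⁺, ψ⁻ : ℝ² → ℂ with ψ⁺ continuously differentiable on T⁺, ψ⁻ continuously differentiable on T⁻, and ψ⁺(t, t) = ψ⁻(t, t) for all t ∈ [0, l], one has ∬_{T⁺} (|∂ₓψ⁺|² + |∂_yψ⁺|²) + ∬_{T⁻} (|∂ₓψ⁻|² + |∂_yψ⁻|²) + ∫₀^l α(t) |ψ⁺(t, t)|² dt ≥ −C ( ∬_{T⁺} |ψ⁺|² + ∬_{T⁻} |ψ⁻|²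 ). -/
open MeasureTheory

/-- The closed triangle `T⁺ = {0 ≤ y ≤ x ≤ l}` below the diagonal of `[0, l]²`. -/
def Tplus (l : ℝ) : Set (ℝ × ℝ) := {p : ℝ × ℝ | 0 ≤ p.2 ∧ p.2 ≤ p.1 ∧ p.1 ≤ l}

/-- The closed triangle `T⁻ = {0 ≤ x ≤ y ≤ l}` above the diagonal of `[0, l]²`. -/
def Tminus (l : ℝ) : Set (ℝ × ℝ) := {p : ℝ × ℝ | 0 ≤ p.1 ∧ p.1 ≤ p.2 ∧ p.2 ≤ l}

lemma isCompact_Tplus (l : ℝ) : IsCompact (Tplus l) := by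
  refine (isCompact_Icc (a := ((0, 0) : ℝ × ℝ)) (b := (l, l))).of_isClosed_subset ?_ ?_
  · exact (isClosed_le continuous_const continuous_snd).inter
      ((isClosed_le continuous_snd continuous_fst).inter
        (isClosed_le continuous_fst continuous_const))
  · rintro ⟨x, y⟩ ⟨h1, h2, h3⟩
    simp only at h1 h2 h3
    exact ⟨⟨h1.trans h2, h1⟩, ⟨h3, h2.trans h3⟩⟩

lemma convex_Tplus (l : ℝ) : Convex ℝ (Tplus l) := by
  rintro ⟨x, y⟩ ⟨h1, h2, h3⟩ ⟨x', y'⟩ ⟨h1', h2', h3'⟩ a b ha hb hab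
  simp only at h1 h2 h3 h1' h2' h3'
  refine ⟨?_, ?_, ?_⟩ <;> simp only [Prod.smul_mk, Prod.mk_add_mk, smul_eq_mul]
  · positivity
  · gcongr
  · calc a * x + b * x' ≤ a * l + b * l := by gcongr
      _ = l := by rw [← add_mul, hab, one_mul]

lemma Tplus_mem_nhds {l x y : ℝ} (h1 : 0 < y) (h2 : y < x) (h3 : x < l) :
    Tplus l ∈ nhds (x, y) := by
  have ho : IsOpen {p : ℝ × ℝ | 0 < p.2 ∧ p.2 < p.1 ∧ p.1 < l} :=
    (isOpen_lt continuous_const continuous_snd).inter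
      ((isOpen_lt continuous_snd continuous_fst).inter
        (isOpen_lt continuous_fst continuous_const))
  exact Filter.mem_of_superset (ho.mem_nhds ⟨h1, h2, h3⟩)
    fun p hp => ⟨hp.1.le, hp.2.1.le, hp.2.2.le⟩

lemma uniqueDiffOn_Tplus {l : ℝ} (hl : 0 < l) : UniqueDiffOn ℝ (Tplus l) :=
  uniqueDiffOn_convex (convex_Tplus l) ⟨(l / 2, l / 4), mem_interior_iff_mem_nhds.2
    (Tplus_mem_nhds (by linarith) (by linarith) (by linarith))⟩

/-- Weighted endpoint estimate on an interval, with the weight `x - c`. -/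
lemma endpoint_sq_le_integral {a b c L ε : ℝ} (hac : a ≤ c) (hcb : c ≤ b) (hL : b - a ≤ L)
    (hε : 0 < ε) {f f' : ℝ → ℂ} (hf : ContinuousOn f (Set.Icc a b))
    (hf' : ContinuousOn f' (Set.Icc a b)) (hd : ∀ x ∈ Set.Ioo a b, HasDerivAt f (f' x) x) :
    (b - c) * ‖f b‖ ^ 2 + (c - a) * ‖f a‖ ^ 2 ≤
      ∫ x in a..b, ((1 + L / ε) * ‖f x‖ ^ 2 + L * ε * ‖f' x‖ ^ 2) := by
  have hab : a ≤ b := hac.trans hcb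
  have hcont : ContinuousOn
      (fun x => ‖f x‖ ^ 2 + (x - c) * (2 * inner ℝ (f x) (f' x))) (Set.Icc a b) := by
    fun_prop
  have hftc := intervalIntegral.integral_eq_sub_of_hasDerivAt_of_le hab
    (f := fun x => (x - c) * ‖f x‖ ^ 2) (by fun_prop)
    (f' := fun x => ‖f x‖ ^ 2 + (x - c) * (2 * inner ℝ (f x) (f' x)))
    (fun x hx => by
      have h := ((hasDerivAt_id' x).sub_const c).mul (hd x hx).norm_sq
      rwa [one_mul] at h)
    (hcont.intervalIntegrable_of_Icc hab)
  have hrw : (b - c) * ‖f b‖ ^ 2 + (c - a) * ‖f a‖ ^ 2 =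
      (b - c) * ‖f b‖ ^ 2 - (a - c) * ‖f a‖ ^ 2 := by ring
  rw [hrw, ← hftc]
  refine intervalIntegral.integral_mono_on hab (hcont.intervalIntegrable_of_Icc hab)
    (ContinuousOn.intervalIntegrable_of_Icc hab (by fun_prop)) fun x hx => ?_
  have hL0 : 0 ≤ L := by linarith
  have hxc : |x - c| ≤ L := abs_le.2 ⟨by linarith [hx.1], by linarith [hx.2]⟩
  have hin : (x - c) * (2 * inner ℝ (f x) (f' x)) ≤ L * (2 * (‖f x‖ * ‖f' x‖)) := by
    refine (le_abs_self _).trans ?_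
    rw [abs_mul, abs_mul, abs_two]
    gcongr
    exact abs_real_inner_le_norm _ _
  have hyoung : 2 * (‖f x‖ * ‖f' x‖) ≤ ‖f x‖ ^ 2 / ε + ε * ‖f' x‖ ^ 2 := by
    have h : ‖f x‖ ^ 2 / ε + ε * ‖f' x‖ ^ 2 - 2 * (‖f x‖ * ‖f' x‖) =
        (‖f x‖ - ε * ‖f' x‖) ^ 2 / ε := by field_simp; ring
    have : 0 ≤ (‖f x‖ - ε * ‖f' x‖) ^ 2 / ε := by positivity
    linarith
  have := mul_le_mul_of_nonneg_left hyoung hL0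
  have h2 : L * (‖f x‖ ^ 2 / ε + ε * ‖f' x‖ ^ 2) =
      L / ε * ‖f x‖ ^ 2 + L * ε * ‖f' x‖ ^ 2 := by ring
  linarith

/-- Fubini on `Tplus l`, integrating first along vertical segments. -/
lemma fubini_Tplus_vertical {l : ℝ} (hl : 0 ≤ l) {g : ℝ × ℝ → ℝ}
    (hg : IntegrableOn g (Tplus l)) :
    IntervalIntegrable (fun t => ∫ y in (0:ℝ)..t, g (t, y)) volume 0 l ∧
      ∫ t in (0:ℝ)..l, ∫ y in (0:ℝ)..t, g (t, y) = ∫ p in Tplus l, g p := by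
  have hm := (isCompact_Tplus l).measurableSet
  have hi : Integrable ((Tplus l).indicator g) ((volume : Measure ℝ).prod volume) :=
    (integrable_indicator_iff hm).2 hg
  have hslice : ∀ t, ∫ y, (Tplus l).indicator g (t, y) =
      (Set.Icc 0 l).indicator (fun t => ∫ y in (0:ℝ)..t, g (t, y)) t := by
    intro t
    by_cases ht : t ∈ Set.Icc 0 l
    · rw [Set.indicator_of_mem ht, intervalIntegral.integral_of_le ht.1,
        ← integral_Icc_eq_integral_Ioc, ← integral_indicator measurableSet_Icc]
      congr 1
      ext y
      by_cases hy : y ∈ Set.Icc 0 t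
      · rw [Set.indicator_of_mem hy, Set.indicator_of_mem]
        exact ⟨hy.1, hy.2, ht.2⟩
      · rw [Set.indicator_of_notMem hy, Set.indicator_of_notMem]
        exact fun h => hy ⟨h.1, h.2.1⟩
    · rw [Set.indicator_of_notMem ht]
      refine integral_eq_zero_of_ae (Filter.Eventually.of_forall fun y => ?_)
      exact Set.indicator_of_notMem (fun h => ht ⟨h.1.trans h.2.1, h.2.2⟩) _
  constructor
  · have h := hi.integral_prod_left
    simp only [hslice] at h
    rw [intervalIntegrable_iff_integrableOn_Icc_of_le hl]
    exact (integrable_indicator_iff measurableSet_Icc).1 h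
  · rw [← integral_indicator hm, Measure.volume_eq_prod, integral_prod _ hi]
    simp only [hslice]
    rw [integral_indicator measurableSet_Icc, intervalIntegral.integral_of_le hl,
      integral_Icc_eq_integral_Ioc]

/-- Fubini on `Tplus l`, integrating first along horizontal segments. -/
lemma fubini_Tplus_horizontal {l : ℝ} (hl : 0 ≤ l) {g : ℝ × ℝ → ℝ}
    (hg : IntegrableOn g (Tplus l)) :
    IntervalIntegrable (fun t => ∫ x in t..l, g (x, t)) volume 0 l ∧
      ∫ t in (0:ℝ)..l, ∫ x in t..l, g (x, t) = ∫ p in Tplus l, g p := by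
  have hm := (isCompact_Tplus l).measurableSet
  have hi : Integrable ((Tplus l).indicator g) ((volume : Measure ℝ).prod volume) :=
    (integrable_indicator_iff hm).2 hg
  have hslice : ∀ t, ∫ x, (Tplus l).indicator g (x, t) =
      (Set.Icc 0 l).indicator (fun t => ∫ x in t..l, g (x, t)) t := by
    intro t
    by_cases ht : t ∈ Set.Icc 0 l
    · rw [Set.indicator_of_mem ht, intervalIntegral.integral_of_le ht.2,
        ← integral_Icc_eq_integral_Ioc, ← integral_indicator measurableSet_Icc]
      congr 1
      ext x
      by_cases hx : x ∈ Set.Icc t l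
      · rw [Set.indicator_of_mem hx, Set.indicator_of_mem]
        exact ⟨ht.1, hx.1, hx.2⟩
      · rw [Set.indicator_of_notMem hx, Set.indicator_of_notMem]
        exact fun h => hx ⟨h.2.1, h.2.2⟩
    · rw [Set.indicator_of_notMem ht]
      refine integral_eq_zero_of_ae (Filter.Eventually.of_forall fun x => ?_)
      exact Set.indicator_of_notMem (fun h => ht ⟨h.1, h.2.1.trans h.2.2⟩) _
  constructor
  · have h := hi.integral_prod_right
    simp only [hslice] at h
    rw [intervalIntegrable_iff_integrableOn_Icc_of_le hl]
    exact (integrable_indicator_iff measurableSet_Icc).1 h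
  · rw [← integral_indicator hm, Measure.volume_eq_prod, integral_prod_symm _ hi]
    simp only [hslice]
    rw [integral_indicator measurableSet_Icc, intervalIntegral.integral_of_le hl,
      integral_Icc_eq_integral_Ioc]

/-- Trace inequality for the diagonal side of `Tplus l`. -/
lemma diagonal_trace_le {l ε : ℝ} (hl : 0 < l) (hε : 0 < ε) {u : ℝ × ℝ → ℂ}
    (hu : ContDiffOn ℝ 1 u (Tplus l)) :
    l * ∫ t in (0:ℝ)..l, ‖u (t, t)‖ ^ 2 ≤
      2 * (1 + l / ε) * (∫ p in Tplus l, ‖u p‖ ^ 2) +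
      l * ε * ∫ p in Tplus l, (‖fderiv ℝ u p (1, 0)‖ ^ 2 + ‖fderiv ℝ u p (0, 1)‖ ^ 2) := by
  have hK := isCompact_Tplus l
  have hc : ContinuousOn u (Tplus l) := hu.continuousOn
  have hD : ContinuousOn (fderivWithin ℝ u (Tplus l)) (Tplus l) :=
    hu.continuousOn_fderivWithin (uniqueDiffOn_Tplus hl) le_rfl
  have hDv : ∀ v, ContinuousOn (fun p => fderivWithin ℝ u (Tplus l) p v) (Tplus l) :=
    fun v => hD.clm_apply continuousOn_const
  set D := fderivWithin ℝ u (Tplus l) with hDdef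
  have hder : ∀ {x y : ℝ}, 0 < y → y < x → x < l → HasFDerivAt u (D (x, y)) (x, y) := by
    intro x y h1 h2 h3
    have hn := Tplus_mem_nhds h1 h2 h3
    rw [hDdef, fderivWithin_of_mem_nhds hn]
    exact ((hu.contDiffAt hn).differentiableAt one_ne_zero).hasFDerivAt
  have hgrad : ∫ p in Tplus l, (‖fderiv ℝ u p (1, 0)‖ ^ 2 + ‖fderiv ℝ u p (0, 1)‖ ^ 2) =
      ∫ p in Tplus l, (‖D p (1, 0)‖ ^ 2 + ‖D p (0, 1)‖ ^ 2) := by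
    refine setIntegral_congr_ae hK.measurableSet ?_
    have hfr : ∀ᵐ p : ℝ × ℝ, p ∉ frontier (Tplus l) :=
      measure_eq_zero_iff_ae_notMem.1 ((convex_Tplus l).addHaar_frontier volume)
    filter_upwards [hfr] with p hp hpT
    have hpi : p ∈ interior (Tplus l) := by
      by_contra h
      exact hp ⟨subset_closure hpT, h⟩
    rw [hDdef, fderivWithin_of_mem_nhds (mem_interior_iff_mem_nhds.1 hpi)]
  have hintegrable : ∀ {g : ℝ × ℝ → ℝ}, ContinuousOn g (Tplus l) → IntegrableOn g (Tplus l) :=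
    fun h => h.integrableOn_compact hK
  have hu2 : ContinuousOn (fun p => ‖u p‖ ^ 2) (Tplus l) := hc.norm.pow 2
  have hD2 : ∀ v, ContinuousOn (fun p => ‖D p v‖ ^ 2) (Tplus l) := fun v => (hDv v).norm.pow 2
  have hG : ∀ v, ContinuousOn
      (fun p => (1 + l / ε) * ‖u p‖ ^ 2 + l * ε * ‖D p v‖ ^ 2) (Tplus l) :=
    fun v => (continuousOn_const.mul hu2).add (continuousOn_const.mul (hD2 v))
  have hGi : ∀ v, ∫ p in Tplus l, ((1 + l / ε) * ‖u p‖ ^ 2 + l * ε * ‖D p v‖ ^ 2) =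
      (1 + l / ε) * (∫ p in Tplus l, ‖u p‖ ^ 2) + l * ε * ∫ p in Tplus l, ‖D p v‖ ^ 2 := by
    intro v
    rw [integral_add ((hintegrable hu2).const_mul _) ((hintegrable (hD2 v)).const_mul _),
      integral_const_mul, integral_const_mul]
  obtain ⟨hI1, hF1⟩ := fubini_Tplus_horizontal hl.le (hintegrable (hG (1, 0)))
  obtain ⟨hI2, hF2⟩ := fubini_Tplus_vertical hl.le (hintegrable (hG (0, 1)))
  have hdiag : ContinuousOn (fun t : ℝ => u (t, t)) (Set.Icc 0 l) :=
    hc.comp (by fun_prop) fun t ht => ⟨ht.1, le_rfl, ht.2⟩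
  have hpt : ∀ t ∈ Set.Ioo 0 l, l * ‖u (t, t)‖ ^ 2 ≤
      (∫ x in t..l, ((1 + l / ε) * ‖u (x, t)‖ ^ 2 + l * ε * ‖D (x, t) (1, 0)‖ ^ 2)) +
      ∫ y in (0:ℝ)..t, ((1 + l / ε) * ‖u (t, y)‖ ^ 2 + l * ε * ‖D (t, y) (0, 1)‖ ^ 2) := by
    intro t ht
    have hmapx : Set.MapsTo (fun x : ℝ => (x, t)) (Set.Icc t l) (Tplus l) :=
      fun x hx => ⟨ht.1.le, hx.1, hx.2⟩
    have hmapy : Set.MapsTo (fun y : ℝ => (t, y)) (Set.Icc 0 t) (Tplus l) :=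
      fun y hy => ⟨hy.1, hy.2, ht.2.le⟩
    have h1 := endpoint_sq_le_integral (f := fun x => u (x, t))
      (f' := fun x => D (x, t) (1, 0)) ht.2.le le_rfl
      (show l - t ≤ l by linarith [ht.1]) hε
      (hc.comp (by fun_prop) hmapx) ((hDv (1, 0)).comp (by fun_prop) hmapx)
      fun x hx => (hder ht.1 hx.1 hx.2).comp_hasDerivAt x
        ((hasDerivAt_id x).prodMk (hasDerivAt_const x t))
    have h2 := endpoint_sq_le_integral (f := fun y => u (t, y))
      (f' := fun y => D (t, y) (0, 1)) le_rfl ht.1.le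
      (show t - 0 ≤ l by linarith [ht.2]) hε
      (hc.comp (by fun_prop) hmapy) ((hDv (0, 1)).comp (by fun_prop) hmapy)
      fun y hy => (hder hy.1 hy.2 ht.2).comp_hasDerivAt y
        ((hasDerivAt_const y t).prodMk (hasDerivAt_id y))
    linarith
  have hmono := intervalIntegral.integral_mono_on_of_le_Ioo hl.le
    (ContinuousOn.intervalIntegrable_of_Icc (u := fun t => l * ‖u (t, t)‖ ^ 2) hl.le
      (continuousOn_const.mul (hdiag.norm.pow 2))) (hI1.add hI2) hpt
  rw [intervalIntegral.integral_add hI1 hI2, hF1, hF2, hGi, hGi,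
    intervalIntegral.integral_const_mul] at hmono
  rw [hgrad, integral_add (hintegrable (hD2 _)) (hintegrable (hD2 _))]
  linarith

/-- Semi-boundedness of the quadratic form of the two-particle Laplacian on one edge
with a δ-type contact interaction of bounded measurable strength `α` along the
diagonal: there is `C > 0` such that for all `ψ⁺, ψ⁻` that are `C¹` on `T⁺`, `T⁻`
respectively and agree on the diagonal, the quadratic form is bounded below by
`-C` times the `L²`-norm squared. -/
theorem contact_form_semibounded (l : ℝ) (hl : 0 < l) (α : ℝ → ℝ)
    (hαmeas : Measurable α) (M : ℝ) (hM : 0 ≤ M)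
    (hαbd : ∀ t ∈ Set.Icc (0:ℝ) l, |α t| ≤ M) :
    ∃ C > (0:ℝ), ∀ ψp ψm : ℝ × ℝ → ℂ,
      ContDiffOn ℝ 1 ψp (Tplus l) → ContDiffOn ℝ 1 ψm (Tminus l) →
      (∀ t ∈ Set.Icc (0:ℝ) l, ψp (t, t) = ψm (t, t)) →
      (∫ p in Tplus l, (‖fderiv ℝ ψp p (1, 0)‖ ^ 2 + ‖fderiv ℝ ψp p (0, 1)‖ ^ 2))
        + (∫ p in Tminus l, (‖fderiv ℝ ψm p (1, 0)‖ ^ 2 + ‖fderiv ℝ ψm p (0, 1)‖ ^ 2))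
        + (∫ t in (0:ℝ)..l, α t * ‖ψp (t, t)‖ ^ 2)
      ≥ -C * ((∫ p in Tplus l, ‖ψp p‖ ^ 2) + (∫ p in Tminus l, ‖ψm p‖ ^ 2)) := by
  refine ⟨2 * M * (1 + l * (M + 1)) / l + 1, by positivity, fun ψp ψm hp _ _ => ?_⟩
  have hM1 : 0 < M + 1 := by linarith
  have htrace := diagonal_trace_le hl (inv_pos.2 hM1) hp
  have hdiag : ContinuousOn (fun t : ℝ => ψp (t, t)) (Set.Icc 0 l) :=
    hp.continuousOn.comp (by fun_prop) fun t ht => ⟨ht.1, le_rfl, ht.2⟩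
  have hα : -(M * ∫ t in (0:ℝ)..l, ‖ψp (t, t)‖ ^ 2) ≤
      ∫ t in (0:ℝ)..l, α t * ‖ψp (t, t)‖ ^ 2 := by
    rw [← intervalIntegral.integral_const_mul]
    refine neg_le_of_abs_le ?_
    rw [← Real.norm_eq_abs]
    refine intervalIntegral.norm_integral_le_of_norm_le hl.le
      (Filter.Eventually.of_forall fun t ht => ?_)
      (ContinuousOn.intervalIntegrable_of_Icc (u := fun t => M * ‖ψp (t, t)‖ ^ 2) hl.le
        (continuousOn_const.mul (hdiag.norm.pow 2)))
    rw [norm_mul, Real.norm_eq_abs, Real.norm_of_nonneg (by positivity : 0 ≤ ‖ψp (t, t)‖ ^ 2)]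
    exact mul_le_mul_of_nonneg_right (hαbd t ⟨ht.1.le, ht.2⟩) (by positivity)
  have hgm : 0 ≤ ∫ p in Tminus l,
      (‖fderiv ℝ ψm p (1, 0)‖ ^ 2 + ‖fderiv ℝ ψm p (0, 1)‖ ^ 2) :=
    integral_nonneg fun p => by positivity
  have hgp : 0 ≤ ∫ p in Tplus l,
      (‖fderiv ℝ ψp p (1, 0)‖ ^ 2 + ‖fderiv ℝ ψp p (0, 1)‖ ^ 2) :=
    integral_nonneg fun p => by positivity
  have hup : 0 ≤ ∫ p in Tplus l, ‖ψp p‖ ^ 2 := integral_nonneg fun p => by positivity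
  have hum : 0 ≤ ∫ p in Tminus l, ‖ψm p‖ ^ 2 := integral_nonneg fun p => by positivity
  generalize (∫ p in Tplus l,
    (‖fderiv ℝ ψp p (1, 0)‖ ^ 2 + ‖fderiv ℝ ψp p (0, 1)‖ ^ 2)) = G at *
  generalize (∫ p in Tplus l, ‖ψp p‖ ^ 2) = U at *
  generalize (∫ p in Tminus l, ‖ψm p‖ ^ 2) = V at *
  generalize (∫ t in (0:ℝ)..l, ‖ψp (t, t)‖ ^ 2) = S at *
  have hS : M * S ≤ 2 * M * (1 + l * (M + 1)) / l * U + G := by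
    have h1 : M * S = M / l * (l * S) := by field_simp
    have h2 : M / l * (2 * (1 + l / (M + 1)⁻¹) * U + l * (M + 1)⁻¹ * G) =
        2 * M * (1 + l * (M + 1)) / l * U + M / (M + 1) * G := by field_simp
    have h3 : M / (M + 1) * G ≤ G :=
      mul_le_of_le_one_left hgp ((div_le_one hM1).2 (by linarith))
    have h4 := mul_le_mul_of_nonneg_left htrace (div_nonneg hM hl.le)
    linarith
  have hV : 0 ≤ 2 * M * (1 + l * (M + 1)) / l * V := by positivity
  linarith
end

section
/- Let N ≥ 2, l > 0, and let α : ℝ → ℝ be measurable with |α(t)| ≤ M for all t ∈ [0, l], for some M ≥ 0. Then there exists a constant C > 0 such that for every function ψ : (Fin N → ℝ) → ℂ that is continuously differentiable on the closed box B = [0, l]^N, one has ∫_B Σ_k |∂_kψ(x)|² dx + Σ_{i < j} (1/l) ∫_B α(xᵢ) |ψ(update(x, j, xᵢ))|² dx ≥ −C ∫_B |ψ(x)|² dx. -/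
open MeasureTheory

/-- A function of one variable on `[0, l]` is bounded pointwise by its `H¹` data, with an arbitrarily
small weight on the derivative. -/
lemma norm_sq_le_integral_of_hasDerivWithinAt {l ε : ℝ} (hl : 0 < l) (hε : 0 < ε) {f f' : ℝ → ℂ}
    (hf : ∀ t ∈ Set.Icc 0 l, HasDerivWithinAt f (f' t) (Set.Icc 0 l) t)
    (hf' : ContinuousOn f' (Set.Icc 0 l)) {s : ℝ} (hs : s ∈ Set.Icc 0 l) :
    ‖f s‖ ^ 2 ≤ ∫ t in Set.Icc 0 l, ((1 / l + 1 / ε) * ‖f t‖ ^ 2 + ε * ‖f' t‖ ^ 2) := by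
  have hfc : ContinuousOn f (Set.Icc 0 l) := fun t ht => (hf t ht).continuousWithinAt
  have hint {g : ℝ → ℝ} (hg : ContinuousOn g (Set.Icc 0 l)) : IntegrableOn g (Set.Icc 0 l) :=
    hg.integrableOn_compact isCompact_Icc
  have hi₁ : IntegrableOn (fun t => ‖f t‖ ^ 2) (Set.Icc 0 l) := hint (hfc.norm.pow 2)
  have hi₂ : IntegrableOn (fun t => ‖f' t‖ ^ 2) (Set.Icc 0 l) := hint (hf'.norm.pow 2)
  set K := ∫ t in Set.Icc 0 l, (ε * ‖f' t‖ ^ 2 + 1 / ε * ‖f t‖ ^ 2) with hK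
  have hcompare : ∀ t ∈ Set.Icc 0 l, ‖f s‖ ^ 2 ≤ ‖f t‖ ^ 2 + K := by
    intro t ht
    have hsub : Set.uIcc t s ⊆ Set.Icc 0 l := Set.uIcc_subset_Icc ht hs
    have hφ : ContinuousOn (fun u => 2 * inner ℝ (f u) (f' u)) (Set.Icc 0 l) :=
      continuousOn_const.mul (hfc.inner hf')
    have hftc : ∫ u in t..s, 2 * inner ℝ (f u) (f' u) = ‖f s‖ ^ 2 - ‖f t‖ ^ 2 := by
      refine intervalIntegral.integral_eq_sub_of_hasDeriv_right ((hfc.norm.pow 2).mono hsub)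
        (fun u hu => ?_) (hφ.mono hsub).intervalIntegrable
      have hu' : u ∈ Set.Ioo 0 l :=
        ⟨lt_of_le_of_lt (le_min ht.1 hs.1) hu.1, hu.2.trans_le (max_le ht.2 hs.2)⟩
      exact ((hf u (Set.Ioo_subset_Icc_self hu')).hasDerivAt
        (Icc_mem_nhds hu'.1 hu'.2)).norm_sq.hasDerivWithinAt
    have hbound : ‖∫ u in t..s, 2 * inner ℝ (f u) (f' u)‖ ≤ K := by
      refine intervalIntegral.norm_integral_le_integral_norm_uIoc.trans ?_
      refine (setIntegral_mono_set (hint hφ).norm (Filter.Eventually.of_forall fun _ => norm_nonneg _)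
        (Set.uIoc_subset_uIcc.trans hsub).eventuallyLE).trans ?_
      refine integral_mono (hint hφ).norm ((hi₂.const_mul ε).add (hi₁.const_mul (1 / ε))) fun u => ?_
      have hinner : |inner ℝ (f u) (f' u)| ≤ ‖f u‖ * ‖f' u‖ := abs_real_inner_le_norm _ _
      have hsq : ε * ‖f' u‖ ^ 2 + 1 / ε * ‖f u‖ ^ 2 - 2 * (‖f u‖ * ‖f' u‖)
          = 1 / ε * (ε * ‖f' u‖ - ‖f u‖) ^ 2 := by
        field_simp
        ring
      have hnn : 0 ≤ 1 / ε * (ε * ‖f' u‖ - ‖f u‖) ^ 2 := by positivity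
      simp only [norm_mul, Real.norm_eq_abs, abs_two]
      linarith
    rw [hftc, Real.norm_eq_abs] at hbound
    linarith [le_abs_self (‖f s‖ ^ 2 - ‖f t‖ ^ 2)]
  have hvol : volume.real (Set.Icc 0 l) = l := by simp [hl.le]
  have hconst (c : ℝ) : ∫ _ in Set.Icc 0 l, c = l * c := by
    rw [setIntegral_const, hvol, smul_eq_mul]
  have hKint : IntegrableOn (fun _ : ℝ => K) (Set.Icc 0 l) := hint continuousOn_const
  have hmono : ∫ _ in Set.Icc 0 l, ‖f s‖ ^ 2 ≤ ∫ t in Set.Icc 0 l, (‖f t‖ ^ 2 + K) :=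
    setIntegral_mono_on (hint continuousOn_const) (hi₁.add hKint) measurableSet_Icc hcompare
  rw [integral_add hi₁ hKint, hconst, hconst, hK,
    integral_add (hi₂.const_mul ε) (hi₁.const_mul (1 / ε)), integral_const_mul,
    integral_const_mul] at hmono
  rw [integral_add (hi₁.const_mul _) (hi₂.const_mul ε), integral_const_mul, integral_const_mul]
  refine le_of_mul_le_mul_left (hmono.trans_eq ?_) hl
  field_simp
  ring

/-- Resampling one coordinate of a product measure reproduces the product measure, up to the total
mass of that coordinate. -/
lemma map_update_pi_prod {ι : Type*} [Fintype ι] [DecidableEq ι] {X : ι → Type*}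
    [∀ i, MeasurableSpace (X i)] (ν : ∀ i, Measure (X i)) [∀ i, IsFiniteMeasure (ν i)]
    (j : ι) (hj : ν j Set.univ ≠ 0) :
    ((Measure.pi ν).prod (ν j)).map (fun p => Function.update p.1 j p.2)
      = ν j Set.univ • Measure.pi ν := by
  have hmeas : Measurable fun p : (∀ i, X i) × X j => Function.update p.1 j p.2 :=
    measurable_update'
  have htop : ν j Set.univ ≠ ⊤ := measure_ne_top _ _
  have hpi : Measure.pi ν = (ν j Set.univ)⁻¹ •
      ((Measure.pi ν).prod (ν j)).map (fun p => Function.update p.1 j p.2) := by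
    refine Measure.pi_eq fun s hs => ?_
    have hpre : (fun p : (∀ i, X i) × X j => Function.update p.1 j p.2) ⁻¹' Set.univ.pi s
        = Set.univ.pi (Function.update s j Set.univ) ×ˢ s j := by
      ext p
      simp only [Set.mem_preimage, Set.mem_univ_pi, Set.mem_prod]
      constructor
      · refine fun h => ⟨fun i => ?_, by simpa using h j⟩
        rcases eq_or_ne i j with rfl | hij
        · simp
        · simpa [hij] using h i
      · rintro ⟨h, h'⟩ i
        rcases eq_or_ne i j with rfl | hij
        · simpa using h'
        · simpa [hij] using h i
    have hprod : ∏ i, ν i (Function.update s j Set.univ i)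
        = ν j Set.univ * ∏ i ∈ Finset.univ.erase j, ν i (s i) := by
      rw [← Finset.mul_prod_erase _ _ (Finset.mem_univ j), Function.update_self]
      congr 1
      exact Finset.prod_congr rfl fun i hi => by
        rw [Function.update_of_ne (Finset.ne_of_mem_erase hi)]
    rw [Measure.smul_apply, Measure.map_apply hmeas (MeasurableSet.univ_pi hs), hpre,
      Measure.prod_prod, Measure.pi_pi, hprod, smul_eq_mul, mul_assoc, ← mul_assoc,
      ENNReal.inv_mul_cancel hj htop, one_mul, mul_comm,
      Finset.mul_prod_erase _ (fun i => ν i (s i)) (Finset.mem_univ j)]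
  conv_rhs => rw [hpi]
  rw [smul_smul, ENNReal.mul_inv_cancel hj htop, one_smul]

section Box

variable {ι : Type*} {l : ℝ}

lemma volume_restrict_box [Fintype ι] :
    (volume : Measure (ι → ℝ)).restrict (Set.Icc 0 fun _ => l)
      = Measure.pi fun _ => (volume : Measure ℝ).restrict (Set.Icc 0 l) := by
  rw [← Set.pi_univ_Icc, volume_pi, Measure.restrict_pi_pi]
  rfl

lemma update_mem_box [DecidableEq ι] {x : ι → ℝ} (hx : x ∈ Set.Icc 0 fun _ => l) (j : ι) {t : ℝ}
    (ht : t ∈ Set.Icc 0 l) : Function.update x j t ∈ Set.Icc 0 fun _ => l := by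
  rw [← Set.pi_univ_Icc] at hx ⊢
  exact Set.update_mem_pi_iff_of_mem hx |>.2 fun _ => ht

variable [Fintype ι] [DecidableEq ι]

lemma integrable_comp_update_box (hl : 0 < l) {g : (ι → ℝ) → ℝ}
    (hg : IntegrableOn g (Set.Icc 0 fun _ => l)) (j : ι) :
    Integrable (fun p : (ι → ℝ) × ℝ => g (Function.update p.1 j p.2))
      ((volume.restrict (Set.Icc 0 fun _ => l)).prod (volume.restrict (Set.Icc 0 l))) ∧
    ∫ x in Set.Icc 0 fun _ => l, ∫ t in Set.Icc 0 l, g (Function.update x j t)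
      = l * ∫ x in Set.Icc 0 fun _ => l, g x := by
  have hmap := map_update_pi_prod
    (fun _ : ι => (volume : Measure ℝ).restrict (Set.Icc 0 l)) j (by simp [hl])
  rw [← volume_restrict_box] at hmap
  have hmeas : Measurable fun p : (ι → ℝ) × ℝ => Function.update p.1 j p.2 := measurable_update'
  have hgm : Integrable g (((volume.restrict (Set.Icc (0 : ι → ℝ) fun _ => l)).prod
      (volume.restrict (Set.Icc 0 l))).map fun p => Function.update p.1 j p.2) := by
    rw [hmap]
    exact hg.smul_measure (measure_ne_top _ _)
  have hcomp := hgm.comp_measurable hmeas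
  refine ⟨hcomp, ?_⟩
  rw [integral_integral (f := fun x t => g (Function.update x j t)) hcomp,
    ← integral_map hmeas.aemeasurable hgm.aestronglyMeasurable, hmap, integral_smul_measure]
  simp [hl.le]

lemma integral_fderiv_box_eq {ψ : (ι → ℝ) → ℂ} :
    ∫ x in Set.Icc 0 fun _ => l, ∑ k, ‖fderiv ℝ ψ x (Pi.single k 1)‖ ^ 2
      = ∫ x in Set.Icc 0 fun _ => l,
          ∑ k, ‖fderivWithin ℝ ψ (Set.Icc 0 fun _ => l) x (Pi.single k 1)‖ ^ 2 := by
  have hae : Set.univ.pi (fun _ : ι => Set.Ioo 0 l) =ᵐ[volume] Set.Icc 0 fun _ => l :=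
    Measure.univ_pi_Ioo_ae_eq_Icc
  rw [← setIntegral_congr_set hae, ← setIntegral_congr_set hae]
  refine setIntegral_congr_fun (MeasurableSet.univ_pi fun _ => measurableSet_Ioo) fun x hx => ?_
  have hnhds : (Set.Icc 0 fun _ => l) ∈ nhds x := by
    rw [← Set.pi_univ_Icc]
    exact set_pi_mem_nhds Set.finite_univ fun i hi => Icc_mem_nhds (hx i hi).1 (hx i hi).2
  simp only [fderivWithin_of_mem_nhds hnhds]

lemma continuousOn_fderivWithin_box (hl : 0 < l) {ψ : (ι → ℝ) → ℂ}
    (hψ : ContDiffOn ℝ 1 ψ (Set.Icc 0 fun _ => l)) (k : ι) :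
    ContinuousOn (fun x => fderivWithin ℝ ψ (Set.Icc 0 fun _ => l) x (Pi.single k 1))
      (Set.Icc 0 fun _ => l) := by
  have huniq : UniqueDiffOn ℝ (Set.Icc (0 : ι → ℝ) fun _ => l) := by
    rw [← Set.pi_univ_Icc]
    exact UniqueDiffOn.univ_pi fun _ => uniqueDiffOn_Icc hl
  exact (hψ.continuousOn_fderivWithin huniq le_rfl).clm_apply continuousOn_const

lemma integrableOn_fderivWithin_box (hl : 0 < l) {ψ : (ι → ℝ) → ℂ}
    (hψ : ContDiffOn ℝ 1 ψ (Set.Icc 0 fun _ => l)) (k : ι) :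
    IntegrableOn (fun x => ‖fderivWithin ℝ ψ (Set.Icc 0 fun _ => l) x (Pi.single k 1)‖ ^ 2)
      (Set.Icc 0 fun _ => l) :=
  ((continuousOn_fderivWithin_box hl hψ k).norm.pow 2).integrableOn_compact isCompact_Icc

/-- Contact terms on the hyperplane `{x_j = x_i}` are controlled by the `L²` norms of the function
and of its `j`-th partial derivative. -/
lemma abs_contact_integral_le (hl : 0 < l) {ε M : ℝ} (hε : 0 < ε) {α : ℝ → ℝ}
    (hα : ∀ t ∈ Set.Icc 0 l, |α t| ≤ M) {ψ : (ι → ℝ) → ℂ}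
    (hψ : ContDiffOn ℝ 1 ψ (Set.Icc 0 fun _ => l)) (i j : ι) :
    |1 / l * ∫ x in Set.Icc 0 fun _ => l, α (x i) * ‖ψ (Function.update x j (x i))‖ ^ 2|
      ≤ M * ((1 / l + 1 / ε) * (∫ x in Set.Icc 0 fun _ => l, ‖ψ x‖ ^ 2)
        + ε * ∫ x in Set.Icc 0 fun _ => l,
            ‖fderivWithin ℝ ψ (Set.Icc 0 fun _ => l) x (Pi.single j 1)‖ ^ 2) := by
  set B : Set (ι → ℝ) := Set.Icc 0 fun _ => l with hB
  set D : (ι → ℝ) → ℂ := fun x => fderivWithin ℝ ψ B x (Pi.single j 1)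
  have hDc : ContinuousOn D B := continuousOn_fderivWithin_box hl hψ j
  have hi₁ : IntegrableOn (fun x => ‖ψ x‖ ^ 2) B :=
    (hψ.continuousOn.norm.pow 2).integrableOn_compact isCompact_Icc
  have hi₂ : IntegrableOn (fun x => ‖D x‖ ^ 2) B := integrableOn_fderivWithin_box hl hψ j
  set g : (ι → ℝ) → ℝ := fun x => (1 / l + 1 / ε) * ‖ψ x‖ ^ 2 + ε * ‖D x‖ ^ 2 with hg
  have hM : 0 ≤ M := (abs_nonneg _).trans (hα 0 ⟨le_rfl, hl.le⟩)
  have hgi : IntegrableOn g B := (hi₁.const_mul _).add (hi₂.const_mul ε)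
  obtain ⟨hprod, hfubini⟩ := integrable_comp_update_box hl hgi j
  have hpoint : ∀ x ∈ B, ‖α (x i) * ‖ψ (Function.update x j (x i))‖ ^ 2‖
      ≤ M * ∫ t in Set.Icc 0 l, g (Function.update x j t) := by
    intro x hx
    have hxi : x i ∈ Set.Icc 0 l := ⟨hx.1 i, hx.2 i⟩
    have hmaps : Set.MapsTo (Function.update x j) (Set.Icc 0 l) B :=
      fun t ht => update_mem_box hx j ht
    have htrace := norm_sq_le_integral_of_hasDerivWithinAt hl hε
      (f := fun t => ψ (Function.update x j t)) (f' := fun t => D (Function.update x j t))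
      (fun t ht => ((hψ.differentiableOn one_ne_zero _ (hmaps ht)).hasFDerivWithinAt
        ).comp_hasDerivWithinAt t (hasDerivAt_update x j t).hasDerivWithinAt hmaps)
      (hDc.comp (continuous_const.update (f := fun _ : ℝ => x) j continuous_id).continuousOn hmaps) hxi
    rw [norm_mul, norm_pow, norm_norm, Real.norm_eq_abs]
    exact mul_le_mul (hα _ hxi) htrace (by positivity) hM
  have hbound := norm_integral_le_of_norm_le (hprod.integral_prod_left.const_mul M)
    ((ae_restrict_iff' measurableSet_Icc).2 (Filter.Eventually.of_forall hpoint))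
  rw [integral_const_mul, hfubini, ← hB, Real.norm_eq_abs] at hbound
  have hsplit : ∫ x in B, g x
      = (1 / l + 1 / ε) * (∫ x in B, ‖ψ x‖ ^ 2) + ε * ∫ x in B, ‖D x‖ ^ 2 := by
    rw [hg, integral_add (hi₁.const_mul _) (hi₂.const_mul ε), integral_const_mul,
      integral_const_mul]
  rw [← hsplit, abs_mul, abs_of_pos (by positivity : 0 < 1 / l)]
  refine (mul_le_mul_of_nonneg_left hbound (by positivity)).trans_eq ?_
  field_simp

end Box

/-- Semi-boundedness of the quadratic form of the `N`-particle Lieb–Liniger-type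
Hamiltonian `-Δ_N + Σ_{i<j} α(xᵢ) δ(xᵢ - x_j)` on the box `[0, l]^N`, for a
bounded measurable interaction strength `α`: there is `C > 0` such that for every
`ψ` continuously differentiable on the box, the kinetic term plus the contact
terms over all coincidence hyperplanes `{x_j = x_i}` is bounded below by `-C`
times the `L²`-norm squared of `ψ`. -/
theorem lieb_liniger_form_semibounded (N : ℕ) (hN : 2 ≤ N) (l : ℝ) (hl : 0 < l)
    (α : ℝ → ℝ) (hαmeas : Measurable α) (M : ℝ) (hM : 0 ≤ M)
    (hαbd : ∀ t ∈ Set.Icc (0:ℝ) l, |α t| ≤ M) :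
    ∃ C > (0:ℝ), ∀ ψ : (Fin N → ℝ) → ℂ,
      ContDiffOn ℝ 1 ψ (Set.Icc (0 : Fin N → ℝ) (fun _ => l)) →
      (∫ x in Set.Icc (0 : Fin N → ℝ) (fun _ => l),
          ∑ k : Fin N, ‖fderiv ℝ ψ x (Pi.single k 1)‖ ^ 2)
        + ∑ j : Fin N, ∑ i ∈ Finset.Iio j,
            (1 / l) * (∫ x in Set.Icc (0 : Fin N → ℝ) (fun _ => l),
              α (x i) * ‖ψ (Function.update x j (x i))‖ ^ 2)
      ≥ -C * (∫ x in Set.Icc (0 : Fin N → ℝ) (fun _ => l), ‖ψ x‖ ^ 2) := by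
  set ε : ℝ := 1 / (N * M + 1) with hε
  have hNM : 0 ≤ N * M := by positivity
  have hεpos : 0 < ε := by positivity
  have hεle : N * M * ε ≤ 1 := by
    rw [hε, mul_one_div, div_le_one (by positivity)]
    linarith
  refine ⟨N * (N * M * (1 / l + 1 / ε)) + 1, by positivity, fun ψ hψ => ?_⟩
  rw [integral_fderiv_box_eq,
    integral_finsetSum _ fun k _ => integrableOn_fderivWithin_box hl hψ k]
  set P := ∫ x in Set.Icc (0 : Fin N → ℝ) (fun _ => l), ‖ψ x‖ ^ 2
  set T : Fin N → ℝ := fun k => ∫ x in Set.Icc (0 : Fin N → ℝ) (fun _ => l),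
    ‖fderivWithin ℝ ψ (Set.Icc 0 fun _ => l) x (Pi.single k 1)‖ ^ 2
  have hPnonneg : 0 ≤ P := integral_nonneg fun _ => by positivity
  have hTnonneg (k : Fin N) : 0 ≤ T k := integral_nonneg fun _ => by positivity
  have hcontact : ∀ j : Fin N, -(N * M * (1 / l + 1 / ε) * P + T j) ≤
      ∑ i ∈ Finset.Iio j, (1 / l) * (∫ x in Set.Icc (0 : Fin N → ℝ) (fun _ => l),
        α (x i) * ‖ψ (Function.update x j (x i))‖ ^ 2) := by
    intro j
    refine (neg_le_neg ?_).trans (neg_abs_le _)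
    refine (Finset.abs_sum_le_sum_abs _ _).trans
      ((Finset.sum_le_sum fun i _ => abs_contact_integral_le hl hεpos hαbd hψ i j).trans ?_)
    rw [Finset.sum_const, nsmul_eq_mul, Fin.card_Iio]
    have hjN : (j : ℝ) ≤ N := by exact_mod_cast j.isLt.le
    have hnn : 0 ≤ M * ((1 / l + 1 / ε) * P + ε * T j) := by
      have := hTnonneg j
      positivity
    refine (mul_le_mul_of_nonneg_right hjN hnn).trans ?_
    linarith [mul_le_mul_of_nonneg_right hεle (hTnonneg j)]
  have hsum := Finset.sum_le_sum fun j (_ : j ∈ Finset.univ) => hcontact j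
  rw [Finset.sum_neg_distrib, Finset.sum_add_distrib, Finset.sum_const, Finset.card_univ,
    Fintype.card_fin, nsmul_eq_mul] at hsum
  linarith
end

section
/- Let N ≥ 1 and let l : Fin N → ℝ with l_e > 0 for all e. For λ ∈ ℝ let 𝒩(λ) be the number of functions k : Fin N → ℕ with k_e ≥ 1 for all e and π² Σ_e k_e²/l_e² ≤ λ. Then 𝒩(λ)/λ^{N/2} tends to (∏_e l_e) / ((4π)^{N/2} · Γ(1 + N/2)) as λ → ∞, where Γ is the Gamma function. -/
open MeasureTheory Set Filter Topology Pointwise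

lemma volume_preimage_mul_abs {l : ℝ} (hl : 0 < l) {A : Set ℝ} (hA : MeasurableSet A) :
    ENNReal.ofReal (l / 2) * volume ((fun t : ℝ => l * |t|) ⁻¹' A) =
      volume.restrict (Ioi 0) A := by
  rw [Measure.restrict_apply hA]
  set P := (l * ·) ⁻¹' (A ∩ Ioi 0) with hP
  set M := (-l * ·) ⁻¹' (A ∩ Ioi 0) with hM
  have hM_meas : MeasurableSet M := (measurable_const_mul _) (hA.inter measurableSet_Ioi)
  have hdisj : Disjoint P M := by
    rw [Set.disjoint_left]
    rintro t ⟨-, h1⟩ ⟨-, h2⟩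
    simp only [mem_Ioi] at h1 h2
    linarith
  have hae : ((fun t : ℝ => l * |t|) ⁻¹' A : Set ℝ) =ᵐ[volume] (P ∪ M : Set ℝ) := by
    have h0 : ∀ᵐ t : ℝ ∂volume, t ≠ 0 := Measure.ae_ne volume 0
    filter_upwards [h0] with t ht
    apply propext
    change l * |t| ∈ A ↔ (l * t ∈ A ∧ 0 < l * t) ∨ (-l * t ∈ A ∧ 0 < -l * t)
    rcases lt_or_gt_of_ne ht with h | h
    · have h3 : ¬ 0 < l * t := by nlinarith
      have h4 : 0 < -l * t := by nlinarith
      have h5 : l * |t| = -l * t := by rw [abs_of_neg h]; ring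
      simp only [h3, h4, h5, and_false, and_true, false_or]
    · have h3 : 0 < l * t := by positivity
      have h4 : ¬ 0 < -l * t := by nlinarith
      simp only [abs_of_pos h, h3, h4, and_false, and_true, or_false]
  rw [measure_congr hae, measure_union hdisj hM_meas, hP, hM,
    Real.volume_preimage_mul_left hl.ne', Real.volume_preimage_mul_left (neg_ne_zero.mpr hl.ne'),
    ← add_mul, ← mul_assoc, inv_neg, abs_neg, abs_of_pos (inv_pos.mpr hl),
    ← ENNReal.ofReal_add (by positivity) (by positivity), ← ENNReal.ofReal_mul (by positivity)]
  have : l / 2 * (l⁻¹ + l⁻¹) = 1 := by field_simp; norm_num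
  rw [this, ENNReal.ofReal_one, one_mul]

lemma volume_sum_sq_le_one {ι : Type*} [Fintype ι] [Nonempty ι] :
    volume {x : ι → ℝ | ∑ i, x i ^ 2 ≤ 1} =
      .ofReal (√Real.pi ^ Fintype.card ι / Real.Gamma (Fintype.card ι / 2 + 1)) := by
  have h := EuclideanSpace.volume_closedBall ι 0 1
  rw [← (PiLp.volume_preserving_toLp ι).measure_preimage
    Metric.isClosed_closedBall.measurableSet.nullMeasurableSet] at h
  rw [ENNReal.ofReal_one, one_pow, one_mul] at h
  rw [← h]
  congr 1
  ext x
  simp [EuclideanSpace.norm_eq]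

/-- The positive part of the ellipsoid with semi-axes `l`. -/
def positiveEllipsoid {ι : Type*} [Fintype ι] (l : ι → ℝ) : Set (ι → ℝ) :=
  {x | (∀ i, 0 < x i) ∧ ∑ i, x i ^ 2 / l i ^ 2 ≤ 1}

section

variable {ι : Type*} [Fintype ι] {l : ι → ℝ}

lemma positiveEllipsoid_eq :
    positiveEllipsoid l = {x | ∑ i, x i ^ 2 / l i ^ 2 ≤ 1} ∩ univ.pi fun _ => Ioi 0 := by
  ext x
  simp [positiveEllipsoid, and_comm]

lemma measurableSet_sum_sq_div_le :
    MeasurableSet {x : ι → ℝ | ∑ i, x i ^ 2 / l i ^ 2 ≤ 1} :=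
  measurableSet_le (by fun_prop) measurable_const

lemma measurableSet_positiveEllipsoid : MeasurableSet (positiveEllipsoid l) := by
  rw [positiveEllipsoid_eq]
  exact measurableSet_sum_sq_div_le.inter (.univ_pi fun _ => measurableSet_Ioi)

lemma convex_positiveEllipsoid : Convex ℝ (positiveEllipsoid l) := by
  rw [positiveEllipsoid_eq]
  refine Convex.inter ?_ (convex_pi fun _ _ => convex_Ioi 0)
  have h : ConvexOn ℝ univ (fun x : ι → ℝ => ∑ i, x i ^ 2 / l i ^ 2) := by
    refine ⟨convex_univ, fun x _ y _ a b ha hb hab => ?_⟩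
    simp only [Pi.add_apply, Pi.smul_apply, smul_eq_mul, Finset.mul_sum, ← Finset.sum_add_distrib]
    refine Finset.sum_le_sum fun i _ => ?_
    rw [← mul_div_assoc, ← mul_div_assoc, ← add_div]
    refine div_le_div_of_nonneg_right ?_ (sq_nonneg _)
    have := (even_two.convexOn_pow (𝕜 := ℝ)).2 (mem_univ (x i)) (mem_univ (y i)) ha hb hab
    simpa using this
  simpa using h.convex_le 1

lemma isBounded_positiveEllipsoid (hl : ∀ i, 0 < l i) :
    Bornology.IsBounded (positiveEllipsoid l) := by
  refine (Bornology.IsBounded.pi (S := fun i => Icc 0 (l i)) fun i =>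
    Metric.isBounded_Icc _ _).subset ?_
  rintro x ⟨hx0, hx⟩ i -
  refine ⟨(hx0 i).le, ?_⟩
  have h1 : x i ^ 2 / l i ^ 2 ≤ 1 :=
    (Finset.single_le_sum (f := fun i => x i ^ 2 / l i ^ 2) (fun j _ => by positivity)
      (Finset.mem_univ i)).trans hx
  rw [div_le_one (pow_pos (hl i) 2)] at h1
  exact le_of_sq_le_sq h1 (hl i).le

lemma smul_positiveEllipsoid_subset {x y : ℝ} (hx : 0 < x) (hxy : x ≤ y) :
    x • positiveEllipsoid l ⊆ y • positiveEllipsoid l := by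
  have hy : 0 < y := hx.trans_le hxy
  rintro _ ⟨v, ⟨hv0, hv⟩, rfl⟩
  refine ⟨(x / y) • v, ⟨fun i => mul_pos (div_pos hx hy) (hv0 i), ?_⟩, ?_⟩
  · refine le_trans (Finset.sum_le_sum fun i _ => ?_) hv
    refine div_le_div_of_nonneg_right ?_ (sq_nonneg _)
    simp only [Pi.smul_apply, smul_eq_mul, mul_pow]
    exact mul_le_of_le_one_left (sq_nonneg _)
      (pow_le_one₀ (by positivity) ((div_le_one hy).mpr hxy))
  · simp only [smul_smul]
    congr 1
    field_simp

lemma volume_positiveEllipsoid [Nonempty ι] (hl : ∀ i, 0 < l i) :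
    volume (positiveEllipsoid l) = (∏ i, ENNReal.ofReal (l i / 2)) *
      .ofReal (√Real.pi ^ Fintype.card ι / Real.Gamma (Fintype.card ι / 2 + 1)) := by
  have hF : Measurable fun (x : ι → ℝ) i => l i * |x i| := by
    rw [measurable_pi_iff]
    intro i
    exact ((measurable_pi_apply i).abs).const_mul _
  have key : (Measure.pi fun _ : ι => (volume : Measure ℝ).restrict (Ioi 0)) =
      (∏ i, ENNReal.ofReal (l i / 2)) •
        (volume : Measure (ι → ℝ)).map (fun x i => l i * |x i|) := by
    refine Measure.pi_eq fun s hs => ?_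
    rw [Measure.smul_apply, Measure.map_apply hF (.univ_pi hs)]
    have : (fun (x : ι → ℝ) i => l i * |x i|) ⁻¹' univ.pi s =
        univ.pi fun i => (fun t : ℝ => l i * |t|) ⁻¹' s i := by
      ext x; simp
    rw [this, volume_pi_pi, smul_eq_mul, ← Finset.prod_mul_distrib]
    exact Finset.prod_congr rfl fun i _ => volume_preimage_mul_abs (hl i) (hs i)
  rw [positiveEllipsoid_eq, ← Measure.restrict_apply measurableSet_sum_sq_div_le, volume_pi,
    Measure.restrict_pi_pi, key, Measure.smul_apply,
    Measure.map_apply hF measurableSet_sum_sq_div_le, smul_eq_mul, ← volume_sum_sq_le_one]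
  congr 2
  ext x
  have (i : ι) : (l i * |x i|) ^ 2 / l i ^ 2 = x i ^ 2 := by
    rw [mul_pow, sq_abs, mul_div_cancel_left₀ _ (pow_pos (hl i) 2).ne']
  simp [this]

lemma card_positiveEllipsoid_inter_lattice {x : ℝ} (hx : 0 < x) :
    Nat.card ↑(positiveEllipsoid l ∩
        x⁻¹ • (Submodule.span ℤ (range (Pi.basisFun ℝ ι)) : Set (ι → ℝ))) =
      Set.ncard {k : ι → ℕ | (∀ i, 1 ≤ k i) ∧ ∑ i, (k i : ℝ) ^ 2 / l i ^ 2 ≤ x ^ 2} := by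
  have hsum (k : ι → ℝ) : ∑ i, (x⁻¹ * k i) ^ 2 / l i ^ 2 ≤ 1 ↔ ∑ i, k i ^ 2 / l i ^ 2 ≤ x ^ 2 := by
    simp_rw [mul_pow, mul_div_assoc, ← Finset.mul_sum]
    rw [inv_pow, inv_mul_le_iff₀ (by positivity), mul_one]
  have hinj : Function.Injective fun (k : ι → ℕ) (i : ι) => x⁻¹ * (k i : ℝ) := by
    intro k k' h
    ext i
    have := congrFun h i
    simpa [hx.ne'] using this
  rw [← Set.ncard_image_of_injective _ hinj]
  change Set.ncard _ = _
  congr 1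
  ext v
  simp only [mem_inter_iff, mem_image, mem_ofPred_eq, Set.mem_smul_set, SetLike.mem_coe,
    Module.Basis.mem_span_iff_repr_mem, Pi.basisFun_repr]
  constructor
  · rintro ⟨⟨h0, h1⟩, w, hw, rfl⟩
    simp only [Pi.smul_apply, smul_eq_mul] at h0 h1
    choose z hz using hw
    have hzpos (i : ι) : 0 < z i := by
      have := (mul_pos_iff_of_pos_left (inv_pos.mpr hx)).mp (h0 i)
      rw [← hz i] at this
      simpa using this
    have hcast (i : ι) : ((z i).toNat : ℝ) = w i := by
      rw [← hz i, ← Int.cast_natCast, Int.toNat_of_nonneg (hzpos i).le]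
      simp
    refine ⟨fun i => (z i).toNat, ⟨fun i => ?_, ?_⟩, ?_⟩
    · exact Int.pos_iff_toNat_pos.mp (hzpos i)
    · simp_rw [hcast]
      exact (hsum w).mp h1
    · ext i
      simp [hcast]
  · rintro ⟨k, ⟨h0, h1⟩, rfl⟩
    refine ⟨⟨fun i => ?_, (hsum _).mpr h1⟩, fun i => (k i : ℝ), fun i => ⟨k i, by simp⟩, ?_⟩
    · have : (0 : ℝ) < k i := Nat.cast_pos.mpr (h0 i)
      positivity
    · ext i
      simp

end

/-- `N`-particle Weyl law on the box `∏_e (0, l_e)`: the number `𝒩(λ)` of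
functions `k : Fin N → ℕ` with all `k_e ≥ 1` and `π² Σ_e k_e²/l_e² ≤ λ`
satisfies `𝒩(λ)/λ^{N/2} → (∏_e l_e) / ((4π)^{N/2} Γ(1 + N/2))` as `λ → ∞`. -/
theorem dirichlet_box_weyl_law (N : ℕ) (hN : 1 ≤ N) (l : Fin N → ℝ)
    (hl : ∀ e, 0 < l e) :
    Filter.Tendsto (fun lam : ℝ =>
      ((Set.ncard {k : Fin N → ℕ | (∀ e, 1 ≤ k e) ∧
        Real.pi ^ 2 * (∑ e, (k e : ℝ) ^ 2 / (l e) ^ 2) ≤ lam} : ℕ) : ℝ)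
        / lam ^ ((N : ℝ) / 2))
      Filter.atTop
      (nhds ((∏ e, l e) / ((4 * Real.pi) ^ ((N : ℝ) / 2) * Real.Gamma (1 + N / 2)))) := by
  have : Nonempty (Fin N) := ⟨⟨0, hN⟩⟩
  have hpi := Real.pi_pos
  have hlim := tendsto_card_div_pow_atTop_volume' (positiveEllipsoid l)
    (isBounded_positiveEllipsoid hl) measurableSet_positiveEllipsoid
    (convex_positiveEllipsoid.addHaar_frontier _)
    (fun _ _ hx hxy => smul_positiveEllipsoid_subset hx hxy)
  have hsub : Tendsto (fun lam : ℝ => √lam / Real.pi) atTop atTop :=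
    Real.tendsto_sqrt_atTop.atTop_div_const hpi
  have h := (hlim.comp hsub).div_const (Real.pi ^ N)
  have hGamma : 0 < Real.Gamma (N / 2 + 1) := Real.Gamma_pos_of_pos (by positivity)
  have hval : volume.real (positiveEllipsoid l) / Real.pi ^ N =
      (∏ e, l e) / ((4 * Real.pi) ^ ((N : ℝ) / 2) * Real.Gamma (1 + N / 2)) := by
    have h4 : (4 * Real.pi) ^ ((N : ℝ) / 2) = 2 ^ N * √Real.pi ^ N := by
      rw [Real.rpow_div_two_eq_sqrt _ (by positivity), Real.rpow_natCast, ← mul_pow,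
        Real.sqrt_mul (by norm_num), show (4 : ℝ) = 2 ^ 2 by norm_num,
        Real.sqrt_sq (by norm_num)]
    have hsq : Real.pi ^ N = √Real.pi ^ N * √Real.pi ^ N := by
      rw [← mul_pow, Real.mul_self_sqrt hpi.le]
    have hs : √Real.pi ^ N ≠ 0 := pow_ne_zero _ (Real.sqrt_pos.mpr hpi).ne'
    rw [Measure.real, volume_positiveEllipsoid hl, ENNReal.toReal_mul, ENNReal.toReal_prod,
      Fintype.card_fin, ENNReal.toReal_ofReal (by positivity), h4, hsq, add_comm 1]
    simp_rw [fun i => ENNReal.toReal_ofReal (half_pos (hl i)).le]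
    rw [Finset.prod_div_distrib, Finset.prod_const, Finset.card_univ, Fintype.card_fin]
    field_simp
  rw [← hval]
  refine h.congr' ?_
  filter_upwards [eventually_gt_atTop 0] with lam hlam
  have hset : {k : Fin N → ℕ | (∀ e, 1 ≤ k e) ∧
        Real.pi ^ 2 * (∑ e, (k e : ℝ) ^ 2 / (l e) ^ 2) ≤ lam} =
      {k : Fin N → ℕ | (∀ e, 1 ≤ k e) ∧
        ∑ e, (k e : ℝ) ^ 2 / l e ^ 2 ≤ (√lam / Real.pi) ^ 2} := by
    ext k
    simp only [mem_ofPred_eq, div_pow, Real.sq_sqrt hlam.le,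
      le_div_iff₀ (pow_pos hpi 2), mul_comm]
  simp only [Function.comp_apply]
  rw [card_positiveEllipsoid_inter_lattice (div_pos (Real.sqrt_pos.mpr hlam) hpi), hset,
    Fintype.card_fin, div_div, ← mul_pow, div_mul_cancel₀ _ hpi.ne',
    Real.rpow_div_two_eq_sqrt _ hlam.le, Real.rpow_natCast]
end

section
/- Let l > 0 and let L be a Hermitian 2×2 complex matrix. Then there exists a constant C ≥ 0 such that for every function f : ℝ → ℂ that is continuously differentiable on [0, l], one has ∫₀^l |f'(x)|² dx − Re ⟨v, L·v⟩ ≥ −C ∫₀^l |f(x)|² dx, where v = (f(0), f(l)) ∈ ℂ² and ⟨·,·⟩ is the standard Hermitian inner product on ℂ². -/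
open MeasureTheory Matrix

/-- The sesquilinear form of a `2×2` matrix is bounded by the sum of the norms of its entries. -/
theorem re_star_dotProduct_mulVec_le (L : Matrix (Fin 2) (Fin 2) ℂ) (a b : ℂ) :
    (star (![a, b]) ⬝ᵥ L.mulVec ![a, b]).re ≤
      (‖L 0 0‖ + ‖L 0 1‖ + ‖L 1 0‖ + ‖L 1 1‖) * (‖a‖ ^ 2 + ‖b‖ ^ 2) := by
  have expand : star (![a, b]) ⬝ᵥ L.mulVec ![a, b] =
      star a * (L 0 0 * a + L 0 1 * b) + star b * (L 1 0 * a + L 1 1 * b) := by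
    simp [Matrix.mulVec, dotProduct, Fin.sum_univ_two]
  have bound : ‖star a * (L 0 0 * a + L 0 1 * b) + star b * (L 1 0 * a + L 1 1 * b)‖ ≤
      ‖a‖ * (‖L 0 0‖ * ‖a‖ + ‖L 0 1‖ * ‖b‖) + ‖b‖ * (‖L 1 0‖ * ‖a‖ + ‖L 1 1‖ * ‖b‖) := by
    refine (norm_add_le _ _).trans ?_
    simp only [norm_mul, norm_star]
    gcongr <;> exact (norm_add_le _ _).trans_eq (by simp only [norm_mul])
  have hab : ‖a‖ * ‖b‖ ≤ ‖a‖ ^ 2 + ‖b‖ ^ 2 := by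
    nlinarith [sq_nonneg (‖a‖ - ‖b‖), sq_nonneg ‖a‖, sq_nonneg ‖b‖]
  rw [expand]
  refine ((Complex.re_le_norm _).trans bound).trans ?_
  nlinarith [mul_le_mul_of_nonneg_left hab (norm_nonneg (L 0 1)),
    mul_le_mul_of_nonneg_left hab (norm_nonneg (L 1 0)),
    mul_nonneg (norm_nonneg (L 0 0)) (sq_nonneg ‖b‖),
    mul_nonneg (norm_nonneg (L 1 1)) (sq_nonneg ‖a‖)]

theorem ContDiffOn.integrableOn_norm_deriv_sq {E : Type*} [NormedAddCommGroup E]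
    [NormedSpace ℝ E] {f : ℝ → E} {a b : ℝ} (hab : a < b)
    (hf : ContDiffOn ℝ 1 f (Set.Icc a b)) :
    IntegrableOn (fun x => ‖deriv f x‖ ^ 2) (Set.Icc a b) := by
  have hcont : ContinuousOn (derivWithin f (Set.Icc a b)) (Set.Icc a b) :=
    hf.continuousOn_derivWithin (uniqueDiffOn_Icc hab) le_rfl
  have hint := ((hcont.norm.pow 2).integrableOn_Icc (μ := volume)).mono_set
    Set.Ioo_subset_Icc_self
  rw [integrableOn_Icc_iff_integrableOn_Ioo]
  refine hint.congr_fun (fun x hx => ?_) measurableSet_Ioo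
  simp [derivWithin_of_mem_nhds (Icc_mem_nhds hx.1 hx.2)]

/-- Trace inequality: the boundary values of a `C¹` function on `[0, l]` are controlled by
its `L²` norm and that of its derivative. -/
theorem ContDiffOn.trace_le {E : Type*} [NormedAddCommGroup E] [InnerProductSpace ℝ E]
    {f : ℝ → E} {l : ℝ} (hl : 0 < l) (K : ℝ) (hK : 0 ≤ K)
    (hf : ContDiffOn ℝ 1 f (Set.Icc 0 l)) :
    K * (‖f 0‖ ^ 2 + ‖f l‖ ^ 2) ≤
      (2 * K / l + K ^ 2) * (∫ x in (0:ℝ)..l, ‖f x‖ ^ 2) +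
        ∫ x in (0:ℝ)..l, ‖deriv f x‖ ^ 2 := by
  have hF : IntegrableOn (fun x => ‖f x‖ ^ 2) (Set.Icc 0 l) :=
    (hf.continuousOn.norm.pow 2).integrableOn_Icc
  have hG := hf.integrableOn_norm_deriv_sq hl
  have hderiv : ∀ x ∈ Set.Ioo 0 l, HasDerivAt (fun y => K * (2 / l * y - 1) * ‖f y‖ ^ 2)
      (2 * K / l * ‖f x‖ ^ 2 + K * (2 / l * x - 1) * (2 * Inner.inner ℝ (f x) (deriv f x))) x := by
    intro x hx
    have hfx : HasDerivAt f (deriv f x) x :=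
      ((hf.differentiableOn one_ne_zero).differentiableAt
        (Icc_mem_nhds hx.1 hx.2)).hasDerivAt
    have hw : HasDerivAt (fun y => K * (2 / l * y - 1)) (2 * K / l) x := by
      refine ((((hasDerivAt_id' x).const_mul (2 / l)).sub_const 1).const_mul K).congr_deriv ?_
      ring
    exact hw.mul hfx.norm_sq
  have key := intervalIntegral.sub_le_integral_of_hasDeriv_right_of_le hl.le
    (g := fun y => K * (2 / l * y - 1) * ‖f y‖ ^ 2)
    (φ := fun x => (2 * K / l + K ^ 2) * ‖f x‖ ^ 2 + ‖deriv f x‖ ^ 2)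
    (ContinuousOn.mul (by fun_prop) (hf.continuousOn.norm.pow 2))
    (fun x hx => (hderiv x hx).hasDerivWithinAt)
    (Integrable.fun_add (hF.const_mul _) hG) (fun x hx => ?_)
  · rw [intervalIntegral.integral_add, intervalIntegral.integral_const_mul] at key
    · have h2 : 2 / l * l = 2 := div_mul_cancel₀ _ hl.ne'
      simp only [h2] at key
      linarith
    · exact (intervalIntegrable_iff_integrableOn_Icc_of_le hl.le).2 (hF.const_mul _)
    · exact (intervalIntegrable_iff_integrableOn_Icc_of_le hl.le).2 hG
  · have hw : |2 / l * x - 1| ≤ 1 := by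
      have h1 : 2 / l * x ≤ 2 := by
        rw [div_mul_eq_mul_div, div_le_iff₀ hl]; linarith [hx.2]
      have h0 : 0 ≤ 2 / l * x := mul_nonneg (by positivity) hx.1.le
      rw [abs_le]; constructor <;> linarith
    have hcs : K * (2 / l * x - 1) * (2 * Inner.inner ℝ (f x) (deriv f x)) ≤
        2 * (K * ‖f x‖) * ‖deriv f x‖ := by
      refine (le_abs_self _).trans ?_
      rw [abs_mul, abs_mul, abs_mul, abs_of_nonneg hK, abs_two]
      calc K * |2 / l * x - 1| * (2 * |Inner.inner ℝ (f x) (deriv f x)|)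
          ≤ K * 1 * (2 * (‖f x‖ * ‖deriv f x‖)) := by
            gcongr
            exact abs_real_inner_le_norm _ _
        _ = 2 * (K * ‖f x‖) * ‖deriv f x‖ := by ring
    nlinarith [two_mul_le_add_sq (K * ‖f x‖) ‖deriv f x‖]

/-- Semi-boundedness of the one-particle quadratic form `Q⁽¹⁾_{P,L}` of Kuchment's
theorem on a single edge of length `l`: for a Hermitian `2×2` matrix `L` there is
`C ≥ 0` such that for every `f` continuously differentiable on `[0, l]`,
`∫₀^l |f'|² - Re ⟨v, L v⟩ ≥ -C ∫₀^l |f|²`, where `v = (f(0), f(l))`. -/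
theorem one_particle_form_semibounded (l : ℝ) (hl : 0 < l)
    (L : Matrix (Fin 2) (Fin 2) ℂ) (hL : L.IsHermitian) :
    ∃ C ≥ (0:ℝ), ∀ f : ℝ → ℂ, ContDiffOn ℝ 1 f (Set.Icc 0 l) →
      (∫ x in (0:ℝ)..l, ‖deriv f x‖ ^ 2)
          - (star (![f 0, f l]) ⬝ᵥ L.mulVec ![f 0, f l]).re
        ≥ -C * (∫ x in (0:ℝ)..l, ‖f x‖ ^ 2) := by
  set K : ℝ := ‖L 0 0‖ + ‖L 0 1‖ + ‖L 1 0‖ + ‖L 1 1‖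
  have hK : 0 ≤ K := by positivity
  refine ⟨2 * K / l + K ^ 2, by positivity, fun f hf => ?_⟩
  have hform := re_star_dotProduct_mulVec_le L (f 0) (f l)
  have htrace := hf.trace_le hl K hK
  linarith
end

section
/- Let E ≥ 1 and let l : Fin E → ℝ with l_e > 0 for all e. For λ ∈ ℝ let N(λ) = Σ_{(e₁, e₂) ∈ Fin E × Fin E} #{(m, n) positive integers : π²(m²/l_{e₁}² + n²/l_{e₂}²) ≤ λ}. Then N(λ)/λ tends to ℒ²/(4π) as λ → ∞, where ℒ = Σ_e l_e is the total length. -/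
open MeasureTheory Set
open scoped Pointwise

/-- The part of the ellipse with semi-axes `c` and `d` in the open first quadrant. -/
def quarterEllipse (c d : ℝ) : Set (Fin 2 → ℝ) :=
  {x | 0 < x 0 ∧ 0 < x 1 ∧ (x 0) ^ 2 / c ^ 2 + (x 1) ^ 2 / d ^ 2 ≤ 1}

theorem integral_zero_one_sqrt_one_sub_sq :
    ∫ x in (0 : ℝ)..1, √(1 - x ^ 2) = Real.pi / 4 := by
  have hcont : Continuous fun x : ℝ => √(1 - x ^ 2) := by fun_prop
  have hneg : ∫ x in (-1 : ℝ)..0, √(1 - x ^ 2) = ∫ x in (0 : ℝ)..1, √(1 - x ^ 2) := by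
    have := intervalIntegral.integral_comp_neg (a := 0) (b := 1) fun x : ℝ => √(1 - x ^ 2)
    simpa using this.symm
  have hadd := intervalIntegral.integral_add_adjacent_intervals
    (hcont.intervalIntegrable (μ := volume) (-1) 0) (hcont.intervalIntegrable 0 1)
  rw [integral_sqrt_one_sub_sq, hneg] at hadd
  linarith

theorem measurableSet_quarterEllipse (c d : ℝ) : MeasurableSet (quarterEllipse c d) := by
  have h : Measurable fun x : Fin 2 → ℝ => (x 0) ^ 2 / c ^ 2 + (x 1) ^ 2 / d ^ 2 := by fun_prop
  exact (measurableSet_lt measurable_const (measurable_pi_apply 0)).inter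
    ((measurableSet_lt measurable_const (measurable_pi_apply 1)).inter
      (measurableSet_le h measurable_const))

theorem convex_quarterEllipse (c d : ℝ) : Convex ℝ (quarterEllipse c d) := by
  rintro x ⟨hx0, hx1, hx⟩ y ⟨hy0, hy1, hy⟩ a b ha hb hab
  have hpos : ∀ u v : ℝ, 0 < u → 0 < v → 0 < a * u + b * v := by
    intro u v hu hv
    rcases ha.eq_or_lt with rfl | ha'
    · have : b = 1 := by linarith
      simpa [this] using hv
    · positivity
  have hsq : ∀ u v : ℝ, (a * u + b * v) ^ 2 ≤ a * u ^ 2 + b * v ^ 2 := by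
    intro u v
    obtain rfl : b = 1 - a := by linarith
    nlinarith [mul_nonneg (mul_nonneg ha hb) (sq_nonneg (u - v))]
  refine ⟨by simpa using hpos _ _ hx0 hy0, by simpa using hpos _ _ hx1 hy1, ?_⟩
  simp only [Pi.add_apply, Pi.smul_apply, smul_eq_mul]
  calc _ ≤ (a * x 0 ^ 2 + b * y 0 ^ 2) / c ^ 2 + (a * x 1 ^ 2 + b * y 1 ^ 2) / d ^ 2 := by
        gcongr <;> exact hsq _ _
    _ = a * (x 0 ^ 2 / c ^ 2 + x 1 ^ 2 / d ^ 2) + b * (y 0 ^ 2 / c ^ 2 + y 1 ^ 2 / d ^ 2) := by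
        ring
    _ ≤ a * 1 + b * 1 := by gcongr
    _ = 1 := by linarith

theorem isBounded_quarterEllipse {c d : ℝ} (hc : 0 < c) (hd : 0 < d) :
    Bornology.IsBounded (quarterEllipse c d) := by
  refine (Metric.isBounded_Icc (0 : Fin 2 → ℝ) ![c, d]).subset ?_
  rintro x ⟨hx0, hx1, hx⟩
  have h0 : 0 ≤ x 0 ^ 2 / c ^ 2 := by positivity
  have h1 : 0 ≤ x 1 ^ 2 / d ^ 2 := by positivity
  have hxc : x 0 ^ 2 / c ^ 2 ≤ 1 := by linarith
  have hxd : x 1 ^ 2 / d ^ 2 ≤ 1 := by linarith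
  rw [div_le_one (by positivity), sq_le_sq₀ hx0.le hc.le] at hxc
  rw [div_le_one (by positivity), sq_le_sq₀ hx1.le hd.le] at hxd
  simp [Set.mem_Icc, Pi.le_def, Fin.forall_fin_two, hx0.le, hx1.le, hxc, hxd]

theorem smul_quarterEllipse_mono {c d x y : ℝ} (hx : 0 < x) (hxy : x ≤ y) :
    x • quarterEllipse c d ⊆ y • quarterEllipse c d := by
  have hy : 0 < y := hx.trans_le hxy
  rintro _ ⟨p, ⟨hp0, hp1, hp⟩, rfl⟩
  refine ⟨(x / y) • p, ⟨?_, ?_, ?_⟩, ?_⟩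
  · simp only [Pi.smul_apply, smul_eq_mul]; positivity
  · simp only [Pi.smul_apply, smul_eq_mul]; positivity
  · have h1 : (x / y) ^ 2 ≤ 1 := pow_le_one₀ (by positivity) ((div_le_one hy).2 hxy)
    simp only [Pi.smul_apply, smul_eq_mul]
    calc _ = (x / y) ^ 2 * (p 0 ^ 2 / c ^ 2 + p 1 ^ 2 / d ^ 2) := by ring
      _ ≤ 1 * 1 := by gcongr
      _ = 1 := one_mul 1
  · simp only [smul_smul, mul_div_cancel₀ _ hy.ne']

theorem quarterEllipse_slice (c : ℝ) {d : ℝ} (hd : 0 < d) {x : ℝ} (hx : 0 < x) :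
    {y : ℝ | ![x, y] ∈ quarterEllipse c d} = Ioc 0 (d * √(1 - (x / c) ^ 2)) := by
  ext y
  simp only [quarterEllipse, mem_ofPred_eq, Matrix.cons_val_zero, Matrix.cons_val_one, mem_Ioc, hx,
    true_and, and_congr_right_iff]
  intro hy
  rw [← div_le_iff₀' hd, Real.le_sqrt' (by positivity), div_pow, div_pow]
  constructor <;> intro h <;> linarith

theorem volume_real_quarterEllipse {c d : ℝ} (hc : 0 < c) (hd : 0 < d) :
    volume.real (quarterEllipse c d) = c * d * Real.pi / 4 := by
  have hmp := (volume_preserving_finTwoArrow ℝ).symm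
  have hms := measurableSet_quarterEllipse c d
  have hslice : ∀ x : ℝ, volume {y : ℝ | ![x, y] ∈ quarterEllipse c d} =
      (Ioc 0 c).indicator (fun x => ENNReal.ofReal (d * √(1 - (x / c) ^ 2))) x := by
    intro x
    rcases le_or_gt x 0 with hx | hx
    · simp [quarterEllipse, hx.not_gt]
    · rw [quarterEllipse_slice c hd hx, Real.volume_Ioc, sub_zero]
      by_cases hxc : x ≤ c
      · rw [indicator_of_mem (mem_Ioc.2 ⟨hx, hxc⟩)]
      · rw [indicator_of_notMem (fun h => hxc h.2), Real.sqrt_eq_zero_of_nonpos, mul_zero,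
          ENNReal.ofReal_zero]
        have : 1 ≤ x / c := (one_le_div hc).2 (le_of_not_ge hxc)
        nlinarith
  have hcont : Continuous fun x : ℝ => d * √(1 - (x / c) ^ 2) := by fun_prop
  have hint : ∫ x in (0 : ℝ)..c, d * √(1 - (x / c) ^ 2) = c * d * Real.pi / 4 := by
    rw [intervalIntegral.integral_const_mul,
      intervalIntegral.integral_comp_div (fun x => √(1 - x ^ 2)) hc.ne', zero_div,
      div_self hc.ne', integral_zero_one_sqrt_one_sub_sq, smul_eq_mul]
    ring
  have hvol : volume (quarterEllipse c d) = ENNReal.ofReal (c * d * Real.pi / 4) := by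
    rw [← hmp.measure_preimage hms.nullMeasurableSet, Measure.volume_eq_prod,
      Measure.prod_apply (hmp.measurable hms)]
    change ∫⁻ x : ℝ, volume {y : ℝ | ![x, y] ∈ quarterEllipse c d} = _
    simp_rw [hslice]
    rw [lintegral_indicator measurableSet_Ioc, ← ofReal_integral_eq_lintegral_ofReal,
      ← intervalIntegral.integral_of_le hc.le, hint]
    · exact (hcont.intervalIntegrable 0 c).1
    · exact Filter.Eventually.of_forall fun x => by positivity
  rw [Measure.real, hvol, ENNReal.toReal_ofReal (by positivity)]

theorem card_quarterEllipse_inter_lattice (c d : ℝ) {r : ℝ} (hr : 0 < r) :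
    Nat.card ↑(quarterEllipse c d ∩
        r⁻¹ • (Submodule.span ℤ (Set.range (Pi.basisFun ℝ (Fin 2))) : Set (Fin 2 → ℝ))) =
      Set.ncard {p : ℕ × ℕ | 0 < p.1 ∧ 0 < p.2 ∧
        (p.1 : ℝ) ^ 2 / c ^ 2 + (p.2 : ℝ) ^ 2 / d ^ 2 ≤ r ^ 2} := by
  have hinj : Function.Injective fun p : ℕ × ℕ => r⁻¹ • ![(p.1 : ℝ), (p.2 : ℝ)] := by
    intro p q h
    have h' := smul_right_injective (Fin 2 → ℝ) (inv_ne_zero hr.ne') h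
    have h0 := congrFun h' 0
    have h1 := congrFun h' 1
    simp only [Matrix.cons_val_zero, Matrix.cons_val_one, Nat.cast_inj] at h0 h1
    exact Prod.ext h0 h1
  have hscale : ∀ u v : ℝ, (r⁻¹ * u) ^ 2 / c ^ 2 + (r⁻¹ * v) ^ 2 / d ^ 2 ≤ 1 ↔
      u ^ 2 / c ^ 2 + v ^ 2 / d ^ 2 ≤ r ^ 2 := by
    intro u v
    rw [← div_le_one (by positivity : 0 < r ^ 2)]
    ring_nf
  rw [Nat.card_coe_set_eq, ← Set.ncard_image_of_injective _ hinj]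
  congr 1
  ext x
  constructor
  · rintro ⟨⟨hx0, hx1, hx⟩, z, hz, rfl⟩
    simp only [SetLike.mem_coe, Module.Basis.mem_span_iff_repr_mem, Pi.basisFun_repr,
      Set.mem_range, algebraMap_int_eq, eq_intCast] at hz
    obtain ⟨m, hm⟩ := hz 0
    obtain ⟨n, hn⟩ := hz 1
    simp only [Pi.smul_apply, smul_eq_mul, hscale] at hx0 hx1 hx
    have hz0 : 0 < z 0 := pos_of_mul_pos_right hx0 (inv_nonneg.2 hr.le)
    have hz1 : 0 < z 1 := pos_of_mul_pos_right hx1 (inv_nonneg.2 hr.le)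
    rw [← hm, Int.cast_pos] at hz0
    rw [← hn, Int.cast_pos] at hz1
    lift m to ℕ using hz0.le
    lift n to ℕ using hz1.le
    simp only [Int.cast_natCast] at hm hn
    refine ⟨(m, n), ⟨by exact_mod_cast hz0, by exact_mod_cast hz1, by rwa [hm, hn]⟩, ?_⟩
    ext i
    fin_cases i <;> simp [hm, hn]
  · rintro ⟨⟨m, n⟩, ⟨hm, hn, h⟩, rfl⟩
    have hm' : (0 : ℝ) < m := by exact_mod_cast hm
    have hn' : (0 : ℝ) < n := by exact_mod_cast hn
    refine ⟨⟨?_, ?_, ?_⟩, ![(m : ℝ), (n : ℝ)], ?_, rfl⟩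
    · simpa using mul_pos (inv_pos.2 hr) hm'
    · simpa using mul_pos (inv_pos.2 hr) hn'
    · simpa using (hscale m n).2 h
    · simp only [SetLike.mem_coe, Module.Basis.mem_span_iff_repr_mem, Pi.basisFun_repr,
        Fin.forall_fin_two]
      exact ⟨⟨m, by simp⟩, ⟨n, by simp⟩⟩

/-- Lattice points in a dilated quarter ellipse are counted to leading order by its area. -/
theorem tendsto_ncard_quarterEllipse {c d : ℝ} (hc : 0 < c) (hd : 0 < d) :
    Filter.Tendsto (fun r : ℝ =>
      (Set.ncard {p : ℕ × ℕ | 0 < p.1 ∧ 0 < p.2 ∧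
        (p.1 : ℝ) ^ 2 / c ^ 2 + (p.2 : ℝ) ^ 2 / d ^ 2 ≤ r ^ 2} : ℝ) / r ^ 2)
      Filter.atTop (nhds (c * d * Real.pi / 4)) := by
  rw [← volume_real_quarterEllipse hc hd]
  refine (tendsto_card_div_pow_atTop_volume' (quarterEllipse c d) (isBounded_quarterEllipse hc hd)
    (measurableSet_quarterEllipse c d) ((convex_quarterEllipse c d).addHaar_frontier volume)
    fun _ _ => smul_quarterEllipse_mono).congr' ?_
  filter_upwards [Filter.eventually_gt_atTop 0] with r hr
  rw [card_quarterEllipse_inter_lattice c d hr, Fintype.card_fin]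

/-- Weyl's law for the Dirichlet Laplacian on the rectangle `(0, a) × (0, b)`. -/
theorem rectangle_dirichlet_weyl_law {a b : ℝ} (ha : 0 < a) (hb : 0 < b) :
    Filter.Tendsto (fun lam : ℝ =>
      (Set.ncard {p : ℕ × ℕ | 0 < p.1 ∧ 0 < p.2 ∧
        Real.pi ^ 2 * ((p.1 : ℝ) ^ 2 / a ^ 2 + (p.2 : ℝ) ^ 2 / b ^ 2) ≤ lam} : ℝ) / lam)
      Filter.atTop (nhds (a * b / (4 * Real.pi))) := by
  have hpi := Real.pi_pos
  have h := (tendsto_ncard_quarterEllipse (div_pos ha hpi) (div_pos hb hpi)).comp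
    Real.tendsto_sqrt_atTop
  have hlim : a / Real.pi * (b / Real.pi) * Real.pi / 4 = a * b / (4 * Real.pi) := by
    field_simp
  rw [hlim] at h
  refine h.congr' ?_
  filter_upwards [Filter.eventually_ge_atTop 0] with lam hlam
  have hscale : ∀ u v : ℝ, u ^ 2 / (a / Real.pi) ^ 2 + v ^ 2 / (b / Real.pi) ^ 2 =
      Real.pi ^ 2 * (u ^ 2 / a ^ 2 + v ^ 2 / b ^ 2) := by
    intro u v
    field_simp
  simp only [Function.comp_apply, Real.sq_sqrt hlam, hscale]


/-- Two-particle Weyl law for the Dirichlet Laplacian on the disjoint union of the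
rectangles `(0, l_{e₁}) × (0, l_{e₂})` over all ordered pairs of edges of a compact
metric graph with edge lengths `l_e`: the total eigenvalue count `N(λ)` satisfies
`N(λ)/λ → ℒ²/(4π)` as `λ → ∞`, where `ℒ = Σ_e l_e` is the total length. -/
theorem two_particle_dirichlet_weyl_law (E : ℕ) (hE : 1 ≤ E) (l : Fin E → ℝ)
    (hl : ∀ e, 0 < l e) :
    Filter.Tendsto (fun lam : ℝ =>
      (∑ e₁ : Fin E, ∑ e₂ : Fin E,
        ((Set.ncard {p : ℕ × ℕ | 0 < p.1 ∧ 0 < p.2 ∧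
          Real.pi ^ 2 * ((p.1 : ℝ) ^ 2 / (l e₁) ^ 2 + (p.2 : ℝ) ^ 2 / (l e₂) ^ 2)
            ≤ lam} : ℕ) : ℝ)) / lam)
      Filter.atTop (nhds ((∑ e, l e) ^ 2 / (4 * Real.pi))) := by
  have hlim : (∑ e, l e) ^ 2 / (4 * Real.pi) =
      ∑ e₁, ∑ e₂, l e₁ * l e₂ / (4 * Real.pi) := by
    rw [sq, Finset.sum_mul_sum, Finset.sum_div]
    simp_rw [Finset.sum_div]
  rw [hlim]
  simp_rw [Finset.sum_div]
  exact tendsto_finsetSum _ fun e₁ _ => tendsto_finsetSum _ fun e₂ _ =>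
    rectangle_dirichlet_weyl_law (hl e₁) (hl e₂)
end
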